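/- The pattern sets {31245, 32145} and {12345, 21345} are shape-Wilf-equivalent. -/

import Mathlib

/-- A pattern is a permutation of `Fin k` for some `k : ℕ` (a permutation of length `k`,
written 0-indexed). -/
def Pattern : Type := Σ k : ℕ, Equiv.Perm (Fin k)

/-- Build a pattern from an explicit vector of values (0-indexed one-line notation). -/
noncomputable def mkPattern {k : ℕ} (v : Fin k → Fin k) (h : Function.Bijective v := by decide) : Pattern :=
  ⟨k, Equiv.ofBijective v h⟩

/-- The permutation `π` of length `n` contains an occurrence of the pattern `p`:
there are indices `i₁ < ⋯ < i_k` (given by a strictly monotone `f`) such that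
`π (f a) < π (f b) ↔ p a < p b` for all `a b`. -/
def PermContains {n : ℕ} (π : Equiv.Perm (Fin n)) (p : Pattern) : Prop :=
  ∃ f : Fin p.1 → Fin n, StrictMono f ∧
    ∀ a b : Fin p.1, π (f a) < π (f b) ↔ p.2 a < p.2 b

/-- `π` avoids every pattern in the set `S`. -/
def AvoidsSet {n : ℕ} (π : Equiv.Perm (Fin n)) (S : Set Pattern) : Prop :=
  ∀ p ∈ S, ¬ PermContains π p

/-- Two sets of patterns are Wilf-equivalent: for every `n ≥ 1`, the number of
permutations of length `n` avoiding every pattern of `S1` equals the number of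
permutations of length `n` avoiding every pattern of `S2`. -/
def WilfEquiv (S1 S2 : Set Pattern) : Prop :=
  ∀ n : ℕ, 1 ≤ n →
    Nat.card {π : Equiv.Perm (Fin n) // AvoidsSet π S1} =
    Nat.card {π : Equiv.Perm (Fin n) // AvoidsSet π S2}

/-- A Ferrers board on `[n] × [n]`: a downward-closed set of cells `(column, row)`
(0-indexed). -/
structure FerrersBoard (n : ℕ) where
  cells : Set (Fin n × Fin n)
  downward_closed : ∀ ⦃i j i' j' : Fin n⦄, (i, j) ∈ cells → i' ≤ i → j' ≤ j → (i', j') ∈ cells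

/-- `σ` is a filling of the Ferrers board `F`: each rook `(i, σ i)` lies on the board. -/
def IsFilling {n : ℕ} (F : FerrersBoard n) (σ : Equiv.Perm (Fin n)) : Prop :=
  ∀ i : Fin n, (i, σ i) ∈ F.cells

/-- The filling `σ` of `F` contains an occurrence of the pattern `p`: there are
columns `f 0 < f 1 < ⋯` whose rooks are order-isomorphic to `p`, and the whole
rectangle spanned by the occurrence lies in `F` (equivalently, by downward closure,
the top-right corner cell lies in `F`). -/
def FillingContains {n : ℕ} (F : FerrersBoard n) (σ : Equiv.Perm (Fin n)) (p : Pattern) : Prop :=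
  ∃ f : Fin p.1 → Fin n, StrictMono f ∧
    (∀ a b : Fin p.1, σ (f a) < σ (f b) ↔ p.2 a < p.2 b) ∧
    (∀ a b : Fin p.1, (f a, σ (f b)) ∈ F.cells)

/-- The filling `σ` of `F` avoids every pattern in the set `S`. -/
def FillingAvoidsSet {n : ℕ} (F : FerrersBoard n) (σ : Equiv.Perm (Fin n)) (S : Set Pattern) : Prop :=
  ∀ p ∈ S, ¬ FillingContains F σ p

/-- Two sets of patterns are shape-Wilf-equivalent: for every `n ≥ 1` and every
Ferrers board `F` on `[n] × [n]`, the number of fillings of `F` avoiding every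
pattern of `S1` equals the number of fillings of `F` avoiding every pattern of `S2`. -/
def ShapeWilfEquiv (S1 S2 : Set Pattern) : Prop :=
  ∀ n : ℕ, 1 ≤ n → ∀ F : FerrersBoard n,
    Nat.card {σ : Equiv.Perm (Fin n) // IsFilling F σ ∧ FillingAvoidsSet F σ S1} =
    Nat.card {σ : Equiv.Perm (Fin n) // IsFilling F σ ∧ FillingAvoidsSet F σ S2}

open Finset in
open scoped Classical in
/-- In a finite set of a linear order, exactly the two smallest elements have at most one
element below them. -/
theorem card_filter_card_lt_le_one {α : Type*} [LinearOrder α] (D : Finset α) :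
    #{i ∈ D | #{j ∈ D | j < i} ≤ 1} = min 2 #D := by
  induction D using Finset.induction_on_max with
  | empty => simp
  | insert a s ha ih =>
    have has : a ∉ s := fun h => lt_irrefl _ (ha a h)
    have h1 : {j ∈ insert a s | j < a} = s := by
      ext j
      simp only [mem_filter, mem_insert]
      constructor
      · rintro ⟨rfl | h, h'⟩
        · exact absurd h' (lt_irrefl _)
        · exact h
      · exact fun h => ⟨Or.inr h, ha j h⟩
    have h2 : {i ∈ s | #{j ∈ insert a s | j < i} ≤ 1} = {i ∈ s | #{j ∈ s | j < i} ≤ 1} := by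
      refine filter_congr fun i hi => ?_
      rw [filter_insert, if_neg (ha i hi).not_gt]
    rw [filter_insert, h1, h2, card_insert_of_notMem has]
    split_ifs with h
    · rw [card_insert_of_notMem (fun h' => has (mem_filter.1 h').1), ih]
      omega
    · rw [ih]
      omega

open Finset in
open scoped Classical in
theorem card_filter_card_gt_le_one {α : Type*} [LinearOrder α] (D : Finset α) :
    #{i ∈ D | #{j ∈ D | i < j} ≤ 1} = min 2 #D :=
  card_filter_card_lt_le_one (α := αᵒᵈ) D

open Finset in
open scoped Classical in
/-- Every rook `(i, σ i)` with `i ∈ C` has at most one rook below it, in a column of `C`,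
which is `Q`-related to it and whose column meets the row `σ i` inside `G`. -/
def SparseOn {n : ℕ} (Q : Fin n → Fin n → Prop) (G : Set (Fin n × Fin n)) (C : Finset (Fin n))
    (σ : Equiv.Perm (Fin n)) : Prop :=
  ∀ i ∈ C, #{j ∈ C | σ j < σ i ∧ (j, σ i) ∈ G ∧ Q i j} ≤ 1

open Finset in
theorem image_eq_of_eq_off {n : ℕ} {C : Finset (Fin n)} {σ τ : Equiv.Perm (Fin n)}
    (h : ∀ i ∉ C, σ i = τ i) : C.image σ = C.image τ := by
  have key : ∀ {σ τ : Equiv.Perm (Fin n)}, (∀ i ∉ C, σ i = τ i) → C.image σ ⊆ C.image τ := by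
    intro σ τ h r hr
    obtain ⟨i, hi, rfl⟩ := mem_image.1 hr
    refine mem_image.2 ⟨τ.symm (σ i), ?_, by simp⟩
    by_contra hc
    have := h _ hc
    rw [Equiv.apply_symm_apply, EmbeddingLike.apply_eq_iff_eq] at this
    exact hc (by rwa [this])
  exact (key h).antisymm (key fun i hi => (h i hi).symm)

open Finset in
open scoped Classical in
/-- The sparse placements with prescribed rooks outside the columns `C` are counted by filling
the rows from top to bottom. -/
theorem card_sparseOn {n : ℕ} (Q : Fin n → Fin n → Prop) (hirr : ∀ i, ¬ Q i i)
    (hQ : ∀ D : Finset (Fin n), #{i ∈ D | #{j ∈ D | Q i j} ≤ 1} = min 2 #D)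
    (G : Set (Fin n × Fin n)) (hG : ∀ ⦃i r s⦄, (i, r) ∈ G → s ≤ r → (i, s) ∈ G)
    (C : Finset (Fin n)) (σ₀ : Equiv.Perm (Fin n)) :
    #{σ : Equiv.Perm (Fin n) | (∀ i ∉ C, σ i = σ₀ i) ∧ (∀ i ∈ C, (i, σ i) ∈ G) ∧
        SparseOn Q G C σ} =
      ∏ r ∈ C.image σ₀, min 2 (#{j ∈ C | (j, r) ∈ G} - #{s ∈ C.image σ₀ | r < s}) := by
  induction hm : #C generalizing C σ₀ with
  | zero =>
    obtain rfl := card_eq_zero.1 hm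
    rw [image_empty, prod_empty, card_eq_one]
    refine ⟨σ₀, ?_⟩
    ext σ
    simp only [mem_filter, mem_univ, true_and, mem_singleton]
    constructor
    · exact fun h => Equiv.ext fun i => h.1 i (notMem_empty i)
    · rintro rfl
      exact ⟨fun _ _ => rfl, by simp, by simp [SparseOn]⟩
  | succ m ih =>
    have hne : (C.image σ₀).Nonempty := by
      rw [image_nonempty, ← card_pos]
      omega
    set R := C.image σ₀ with hR
    set h := R.max' hne with hh
    have hhR : h ∈ R := R.max'_mem hne
    have hle : ∀ r ∈ R, r ≤ h := fun r hr => R.le_max' r hr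
    obtain ⟨m₀, hm₀C, hm₀⟩ := mem_image.1 hhR
    set D := {j ∈ C | (j, h) ∈ G} with hD
    set P := ∏ r ∈ R.erase h, min 2 (#{j ∈ C | (j, r) ∈ G} - #{s ∈ R | r < s}) with hP
    have hfib : ∀ i ∈ {i ∈ D | #{j ∈ D | Q i j} ≤ 1},
        #{σ ∈ {σ : Equiv.Perm (Fin n) | (∀ i ∉ C, σ i = σ₀ i) ∧ (∀ i ∈ C, (i, σ i) ∈ G) ∧
          SparseOn Q G C σ} | σ.symm h = i} = P := by
      intro i hi
      obtain ⟨hiD, hi1⟩ := mem_filter.1 hi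
      obtain ⟨hiC, hiG⟩ := mem_filter.1 hiD
      set σ₁ := (Equiv.swap i m₀).trans σ₀ with hσ₁
      have hσ₁i : σ₁ i = h := by simp [hσ₁, hm₀]
      have hσ₁off : ∀ j ∉ C, σ₁ j = σ₀ j := by
        intro j hj
        have h1 : j ≠ i := fun e => hj (e ▸ hiC)
        have h2 : j ≠ m₀ := fun e => hj (e ▸ hm₀C)
        simp [hσ₁, Equiv.swap_apply_of_ne_of_ne h1 h2]
      have hR₁ : (C.erase i).image σ₁ = R.erase h := by
        rw [image_erase σ₁.injective, hσ₁i, image_eq_of_eq_off hσ₁off]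
      have hcard : #(C.erase i) = m := by
        rw [card_erase_of_mem hiC]
        omega
      have hrec := ih (C.erase i) σ₁ hcard
      rw [hR₁] at hrec
      have hprod : ∏ r ∈ R.erase h, min 2 (#{j ∈ C.erase i | (j, r) ∈ G} -
          #{s ∈ R.erase h | r < s}) = P := by
        refine prod_congr rfl fun r hr => ?_
        have hrh : r < h := lt_of_le_of_ne (hle r (mem_of_mem_erase hr)) (ne_of_mem_erase hr)
        have e1 : #{j ∈ C.erase i | (j, r) ∈ G} + 1 = #{j ∈ C | (j, r) ∈ G} := by
          rw [filter_erase, card_erase_add_one]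
          exact mem_filter.2 ⟨hiC, hG hiG hrh.le⟩
        have e2 : #{s ∈ R.erase h | r < s} + 1 = #{s ∈ R | r < s} := by
          rw [filter_erase, card_erase_add_one]
          exact mem_filter.2 ⟨hhR, hrh⟩
        rw [← e1, ← e2, Nat.add_sub_add_right]
      rw [← hprod, ← hrec, filter_filter]
      congr 1
      refine filter_congr fun σ _ => ?_
      have hsymm : σ.symm h = i ↔ σ i = h := by
        rw [Equiv.symm_apply_eq, eq_comm]
      have hoff : ((∀ j ∉ C, σ j = σ₀ j) ∧ σ i = h) ↔ ∀ j ∉ C.erase i, σ j = σ₁ j := by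
        constructor
        · rintro ⟨h1, h2⟩ j hj
          by_cases hji : j = i
          · rw [hji, h2, hσ₁i]
          · have hjC : j ∉ C := fun hc => hj (mem_erase.2 ⟨hji, hc⟩)
            rw [h1 j hjC, hσ₁off j hjC]
        · intro h1
          refine ⟨fun j hj => ?_, ?_⟩
          · rw [h1 j fun hc => hj (mem_of_mem_erase hc), hσ₁off j hj]
          · rw [h1 i (notMem_erase i C), hσ₁i]
      have hrest : (∀ j ∉ C, σ j = σ₀ j) → σ i = h →
          (((∀ j ∈ C, (j, σ j) ∈ G) ∧ SparseOn Q G C σ) ↔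
            (∀ j ∈ C.erase i, (j, σ j) ∈ G) ∧ SparseOn Q G (C.erase i) σ) := by
        intro hoffC hσi
        have hlt : ∀ j ∈ C, j ≠ i → σ j < h := by
          intro j hj hji
          refine lt_of_le_of_ne (hle _ ?_) fun e => hji (σ.injective (e.trans hσi.symm))
          rw [hR, ← image_eq_of_eq_off hoffC]
          exact mem_image_of_mem _ hj
        have hcol : ∀ k ∈ C.erase i, {j ∈ C | σ j < σ k ∧ (j, σ k) ∈ G ∧ Q k j} =
            {j ∈ C.erase i | σ j < σ k ∧ (j, σ k) ∈ G ∧ Q k j} := by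
          intro k hk
          have hk' := hlt k (mem_of_mem_erase hk) (ne_of_mem_erase hk)
          ext j
          simp only [mem_filter, mem_erase]
          constructor
          · rintro ⟨hj, hjk, hr⟩
            refine ⟨⟨?_, hj⟩, hjk, hr⟩
            rintro rfl
            rw [hσi] at hjk
            exact lt_asymm hjk hk'
          · rintro ⟨⟨-, hj⟩, hr⟩
            exact ⟨hj, hr⟩
        have htop : {j ∈ C | σ j < σ i ∧ (j, σ i) ∈ G ∧ Q i j} = {j ∈ D | Q i j} := by
          ext j
          simp only [hD, mem_filter, hσi]
          constructor
          · rintro ⟨h1, -, h2, h3⟩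
            exact ⟨⟨h1, h2⟩, h3⟩
          · rintro ⟨⟨h1, h2⟩, h3⟩
            exact ⟨h1, hlt j h1 fun e => hirr i (e ▸ h3), h2, h3⟩
        constructor
        · rintro ⟨h1, h2⟩
          refine ⟨fun j hj => h1 j (mem_of_mem_erase hj), fun k hk => ?_⟩
          rw [← hcol k hk]
          exact h2 k (mem_of_mem_erase hk)
        · rintro ⟨h1, h2⟩
          refine ⟨fun j hj => ?_, fun k hk => ?_⟩
          · by_cases hji : j = i
            · rw [hji, hσi]
              exact hiG
            · exact h1 j (mem_erase.2 ⟨hji, hj⟩)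
          · by_cases hki : k = i
            · rw [hki, htop]
              exact hi1
            · have hk' := mem_erase.2 ⟨hki, hk⟩
              rw [hcol k hk']
              exact h2 k hk'
      rw [hsymm, ← hoff]
      tauto
    have hmaps : ∀ σ ∈ ({σ : Equiv.Perm (Fin n) | (∀ i ∉ C, σ i = σ₀ i) ∧
        (∀ i ∈ C, (i, σ i) ∈ G) ∧ SparseOn Q G C σ} : Finset _),
        σ.symm h ∈ {i ∈ D | #{j ∈ D | Q i j} ≤ 1} := by
      intro σ hσ
      obtain ⟨-, hoff, hGσ, hs⟩ := mem_filter.1 hσ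
      have hRσ : R = C.image σ := (image_eq_of_eq_off hoff).symm
      obtain ⟨i, hiC, hi⟩ := mem_image.1 (hRσ ▸ hhR)
      have hsi : σ.symm h = i := by rw [← hi, Equiv.symm_apply_apply]
      rw [hsi]
      refine mem_filter.2 ⟨mem_filter.2 ⟨hiC, hi ▸ hGσ i hiC⟩, ?_⟩
      refine (card_le_card fun j hj => ?_).trans (hs i hiC)
      obtain ⟨hjD, hij⟩ := mem_filter.1 hj
      obtain ⟨hjC, hjG⟩ := mem_filter.1 hjD
      refine mem_filter.2 ⟨hjC, ?_, hi ▸ hjG, hij⟩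
      rw [hi]
      refine lt_of_le_of_ne (hle _ (hRσ ▸ mem_image_of_mem _ hjC)) fun e => ?_
      obtain rfl := σ.injective (e.trans hi.symm)
      exact hirr _ hij
    rw [card_eq_sum_card_fiberwise hmaps, sum_congr rfl hfib, sum_const, hQ, smul_eq_mul,
      ← mul_prod_erase R _ hhR]
    have h0 : #{s ∈ R | h < s} = 0 := by
      rw [card_eq_zero, filter_eq_empty_iff]
      exact fun s hs => (hle s hs).not_gt
    rw [h0, Nat.sub_zero]

/-- The cells having two increasing rooks of `σ` strictly above and to the right. -/
def ascentShadow {n : ℕ} (σ : Equiv.Perm (Fin n)) : Set (Fin n × Fin n) :=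
  {c | ∃ a b, c.1 < a ∧ a < b ∧ c.2 < σ a ∧ σ a < σ b}

theorem ascentShadow_mono {n : ℕ} {σ : Equiv.Perm (Fin n)} {i j r s : Fin n}
    (h : (i, r) ∈ ascentShadow σ) (hj : j ≤ i) (hs : s ≤ r) : (j, s) ∈ ascentShadow σ := by
  obtain ⟨a, b, h1, h2, h3, h4⟩ := h
  exact ⟨a, b, hj.trans_lt h1, h2, hs.trans_lt h3, h4⟩

/-- A witness for membership in the shadow may be chosen outside the shadow. -/
theorem exists_witness_notMem_ascentShadow {n : ℕ} {σ : Equiv.Perm (Fin n)} {i r : Fin n}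
    (h : (i, r) ∈ ascentShadow σ) :
    ∃ a b, i < a ∧ a < b ∧ r < σ a ∧ σ a < σ b ∧
      (a, σ a) ∉ ascentShadow σ ∧ (b, σ b) ∉ ascentShadow σ := by
  induction hk : n - (i : ℕ) using Nat.strong_induction_on generalizing i r with
  | _ k ih =>
    obtain ⟨a, b, h1, h2, h3, h4⟩ := h
    have step : ∀ c, i < c → r < σ c → (c, σ c) ∈ ascentShadow σ →
        ∃ a b, i < a ∧ a < b ∧ r < σ a ∧ σ a < σ b ∧
          (a, σ a) ∉ ascentShadow σ ∧ (b, σ b) ∉ ascentShadow σ := by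
      intro c hic hrc hc
      obtain ⟨a', b', g1, g2, g3, g4⟩ := ih (n - (c : ℕ)) (by omega) hc rfl
      exact ⟨a', b', hic.trans g1, g2, hrc.trans g3, g4⟩
    by_cases ha : (a, σ a) ∈ ascentShadow σ
    · exact step a h1 h3 ha
    by_cases hb : (b, σ b) ∈ ascentShadow σ
    · exact step b (h1.trans h2) (h3.trans h4) hb
    exact ⟨a, b, h1, h2, h3, h4, ha, hb⟩

theorem ascentShadow_eq_of_eq_off {n : ℕ} {σ τ : Equiv.Perm (Fin n)}
    (hoff : ∀ i, (i, τ i) ∉ ascentShadow τ → σ i = τ i)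
    (hin : ∀ i, (i, τ i) ∈ ascentShadow τ → (i, σ i) ∈ ascentShadow τ) :
    ascentShadow σ = ascentShadow τ := by
  refine Set.Subset.antisymm ?_ ?_
  · rintro ⟨i, r⟩ ⟨a, b, h1, h2, h3, h4⟩
    by_cases ha : (a, τ a) ∈ ascentShadow τ
    · exact ascentShadow_mono (hin a ha) h1.le h3.le
    by_cases hb : (b, τ b) ∈ ascentShadow τ
    · exact ascentShadow_mono (hin b hb) (h1.trans h2).le (h3.trans h4).le
    rw [hoff a ha] at h3 h4
    rw [hoff b hb] at h4
    exact ⟨a, b, h1, h2, h3, h4⟩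
  · rintro ⟨i, r⟩ h
    obtain ⟨a, b, h1, h2, h3, h4, ha, hb⟩ := exists_witness_notMem_ascentShadow h
    refine ⟨a, b, h1, h2, ?_, ?_⟩
    · rw [hoff a ha]
      exact h3
    · rw [hoff a ha, hoff b hb]
      exact h4

open scoped Classical in
/-- The shadow of `σ`, together with the rooks outside of it. -/
noncomputable def shadowKey {n : ℕ} (σ : Equiv.Perm (Fin n)) :
    Set (Fin n × Fin n) × (Fin n → Option (Fin n)) :=
  (ascentShadow σ, fun i => if (i, σ i) ∈ ascentShadow σ then none else some (σ i))

open scoped Classical in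
theorem shadowKey_eq_iff {n : ℕ} {σ τ : Equiv.Perm (Fin n)} :
    shadowKey σ = shadowKey τ ↔ (∀ i, (i, τ i) ∉ ascentShadow τ → σ i = τ i) ∧
      ∀ i, (i, τ i) ∈ ascentShadow τ → (i, σ i) ∈ ascentShadow τ := by
  constructor
  · intro h
    have h1 : ascentShadow σ = ascentShadow τ := congrArg Prod.fst h
    have h2 : ∀ i, (if (i, σ i) ∈ ascentShadow σ then none else some (σ i)) =
        if (i, τ i) ∈ ascentShadow τ then none else some (τ i) :=
      fun i => congrFun (congrArg Prod.snd h) i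
    rw [h1] at h2
    constructor
    · intro i hi
      have := h2 i
      rw [if_neg hi] at this
      split_ifs at this
      exact Option.some.inj this
    · intro i hi
      by_contra hc
      have := h2 i
      rw [if_pos hi, if_neg hc] at this
      exact absurd this (by simp)
  · rintro ⟨hoff, hin⟩
    have h1 := ascentShadow_eq_of_eq_off hoff hin
    refine Prod.ext h1 (funext fun i => ?_)
    change (if (i, σ i) ∈ ascentShadow σ then none else some (σ i)) =
      if (i, τ i) ∈ ascentShadow τ then none else some (τ i)
    rw [h1]
    by_cases hi : (i, τ i) ∈ ascentShadow τ
    · rw [if_pos hi, if_pos (hin i hi)]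
    · rw [hoff i hi]

theorem IsFilling.of_shadowKey_eq {n : ℕ} {F : FerrersBoard n} {σ τ : Equiv.Perm (Fin n)}
    (hτ : IsFilling F τ) (h : shadowKey σ = shadowKey τ) : IsFilling F σ := by
  obtain ⟨hoff, hin⟩ := shadowKey_eq_iff.1 h
  intro i
  by_cases hi : (i, τ i) ∈ ascentShadow τ
  · obtain ⟨a, b, h1, -, h3, -⟩ := hin i hi
    exact F.downward_closed (hτ a) h1.le h3.le
  · rw [hoff i hi]
    exact hτ i

open scoped Classical in
/-- The columns of the rooks of `σ` lying in the shadow of `σ`. -/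
noncomputable def shadowColumns {n : ℕ} (σ : Equiv.Perm (Fin n)) : Finset (Fin n) :=
  {i | (i, σ i) ∈ ascentShadow σ}

theorem mem_shadowColumns {n : ℕ} {σ : Equiv.Perm (Fin n)} {i : Fin n} :
    i ∈ shadowColumns σ ↔ (i, σ i) ∈ ascentShadow σ := by
  simp [shadowColumns]

theorem shadowColumns_eq {n : ℕ} {σ τ : Equiv.Perm (Fin n)} (h : shadowKey σ = shadowKey τ) :
    shadowColumns σ = shadowColumns τ := by
  have h1 : ascentShadow σ = ascentShadow τ := congrArg Prod.fst h
  obtain ⟨hoff, hin⟩ := shadowKey_eq_iff.1 h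
  ext i
  rw [mem_shadowColumns, mem_shadowColumns, h1]
  refine ⟨fun hi => ?_, hin i⟩
  by_contra hc
  exact hc (hoff i hc ▸ hi)

open Finset in
open scoped Classical in
theorem card_filling_sparseOn_shadow {n : ℕ} (F : FerrersBoard n) :
    #{σ : Equiv.Perm (Fin n) | IsFilling F σ ∧
        SparseOn (fun i j => i < j) (ascentShadow σ) (shadowColumns σ) σ} =
      #{σ : Equiv.Perm (Fin n) | IsFilling F σ ∧
        SparseOn (fun i j => j < i) (ascentShadow σ) (shadowColumns σ) σ} := by
  rw [card_eq_sum_card_fiberwise (f := shadowKey) (t := univ.image shadowKey)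
      fun σ _ => mem_image_of_mem _ (mem_univ σ),
    card_eq_sum_card_fiberwise (f := shadowKey) (t := univ.image shadowKey)
      fun σ _ => mem_image_of_mem _ (mem_univ σ)]
  refine sum_congr rfl fun k hk => ?_
  obtain ⟨τ, -, rfl⟩ := mem_image.1 hk
  by_cases hτ : IsFilling F τ
  · have key : ∀ Q : Fin n → Fin n → Prop,
        ({σ ∈ ({σ | IsFilling F σ ∧ SparseOn Q (ascentShadow σ) (shadowColumns σ) σ} :
          Finset (Equiv.Perm (Fin n))) | shadowKey σ = shadowKey τ}) =
        ({σ | (∀ i ∉ shadowColumns τ, σ i = τ i) ∧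
          (∀ i ∈ shadowColumns τ, (i, σ i) ∈ ascentShadow τ) ∧
          SparseOn Q (ascentShadow τ) (shadowColumns τ) σ} : Finset (Equiv.Perm (Fin n))) := by
      intro Q
      rw [filter_filter]
      refine filter_congr fun σ _ => ?_
      simp only [mem_shadowColumns]
      rw [← and_assoc (c := SparseOn _ _ _ _), ← shadowKey_eq_iff]
      constructor
      · rintro ⟨⟨-, h2⟩, h3⟩
        have h1 : ascentShadow σ = ascentShadow τ := congrArg Prod.fst h3
        rw [h1, shadowColumns_eq h3] at h2
        exact ⟨h3, h2⟩
      · rintro ⟨h3, h2⟩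
        have h1 : ascentShadow σ = ascentShadow τ := congrArg Prod.fst h3
        rw [h1, shadowColumns_eq h3]
        exact ⟨⟨hτ.of_shadowKey_eq h3, h2⟩, h3⟩
    have hG : ∀ ⦃i r s⦄, (i, r) ∈ ascentShadow τ → s ≤ r → (i, s) ∈ ascentShadow τ :=
      fun i r s h hs => ascentShadow_mono h le_rfl hs
    rw [key, key,
      card_sparseOn (fun i j => i < j) (fun i => lt_irrefl i)
        (fun D => by convert card_filter_card_gt_le_one D) _ hG,
      card_sparseOn (fun i j => j < i) (fun i => lt_irrefl i)
        (fun D => by convert card_filter_card_lt_le_one D) _ hG]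
  · have key : ∀ Q : Fin n → Fin n → Prop,
        ({σ ∈ ({σ | IsFilling F σ ∧ SparseOn Q (ascentShadow σ) (shadowColumns σ) σ} :
          Finset (Equiv.Perm (Fin n))) | shadowKey σ = shadowKey τ}) = ∅ := by
      intro Q
      rw [filter_filter, filter_eq_empty_iff]
      rintro σ - ⟨⟨h1, -⟩, h2⟩
      exact hτ (h1.of_shadowKey_eq h2.symm)
    rw [key, key]

open scoped Classical in
theorem not_sparseOn_shadow_iff {n : ℕ} {Q : Fin n → Fin n → Prop} {σ : Equiv.Perm (Fin n)} :
    ¬ SparseOn Q (ascentShadow σ) (shadowColumns σ) σ ↔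
      ∃ i j k, j < k ∧ Q i j ∧ Q i k ∧ σ j < σ i ∧ σ k < σ i ∧
        ∃ a b, i < a ∧ k < a ∧ a < b ∧ σ i < σ a ∧ σ a < σ b := by
  constructor
  · intro h
    simp only [SparseOn, not_forall, not_le, Finset.one_lt_card] at h
    obtain ⟨i, hi, j, hj, k, hk, hjk⟩ := h
    simp only [Finset.mem_filter] at hj hk
    rw [mem_shadowColumns] at hi
    have key : ∀ j k, j < k → Q i j → Q i k → σ j < σ i → σ k < σ i →
        (k, σ i) ∈ ascentShadow σ → ∃ i j k, j < k ∧ Q i j ∧ Q i k ∧ σ j < σ i ∧ σ k < σ i ∧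
        ∃ a b, i < a ∧ k < a ∧ a < b ∧ σ i < σ a ∧ σ a < σ b := by
      intro j k h1 h2 h3 h4 h5 h6
      have h7 : (max i k, σ i) ∈ ascentShadow σ := by
        rcases max_choice i k with e | e <;> rw [e] <;> assumption
      obtain ⟨a, b, g1, g2, g3, g4⟩ := h7
      exact ⟨i, j, k, h1, h2, h3, h4, h5, a, b, (le_max_left _ _).trans_lt g1,
        (le_max_right _ _).trans_lt g1, g2, g3, g4⟩
    rcases lt_or_gt_of_ne hjk with hlt | hlt
    · exact key j k hlt hj.2.2.2 hk.2.2.2 hj.2.1 hk.2.1 hk.2.2.1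
    · exact key k j hlt hk.2.2.2 hj.2.2.2 hk.2.1 hj.2.1 hj.2.2.1
  · rintro ⟨i, j, k, hjk, hQj, hQk, hj, hk, a, b, hia, hka, hab, hσa, hσab⟩ h
    have hmem : ∀ c, c < a → (c, σ i) ∈ ascentShadow σ := fun c hc => ⟨a, b, hc, hab, hσa, hσab⟩
    refine (h i (mem_shadowColumns.2 (hmem i hia))).not_gt (Finset.one_lt_card.2
      ⟨j, Finset.mem_filter.2 ⟨mem_shadowColumns.2 ?_, hj, hmem j (hjk.trans hka), hQj⟩,
        k, Finset.mem_filter.2 ⟨mem_shadowColumns.2 ?_, hk, hmem k hka, hQk⟩, hjk.ne⟩)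
    · exact ascentShadow_mono (hmem j (hjk.trans hka)) le_rfl hj.le
    · exact ascentShadow_mono (hmem k hka) le_rfl hk.le

theorem fillingContains_mkPattern_iff {n : ℕ} {F : FerrersBoard n} {σ : Equiv.Perm (Fin n)}
    (hσ : IsFilling F σ) {v : Fin 5 → Fin 5} (hv : Function.Bijective v) (h4 : v 4 = 4) :
    FillingContains F σ (mkPattern v hv) ↔
      ∃ f : Fin 5 → Fin n, StrictMono f ∧ ∀ a b, v a < v b → σ (f a) < σ (f b) := by
  constructor
  · rintro ⟨f, hf, h, -⟩
    exact ⟨f, hf, fun a b hab => (h a b).2 hab⟩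
  · rintro ⟨f, hf, h⟩
    refine ⟨f, hf, fun a b => ⟨fun hab => ?_, h a b⟩, fun a b => ?_⟩
    · rcases lt_trichotomy (v a) (v b) with hlt | heq | hgt
      · exact hlt
      · exact absurd hab (by rw [hv.injective heq]; exact lt_irrefl _)
      · exact absurd hab (h b a hgt).not_gt
    · change Fin 5 at a b
      refine F.downward_closed (hσ (f 4)) (hf.monotone (Fin.le_last a)) ?_
      rcases ((Fin.le_last (v b)).trans_eq h4.symm).lt_or_eq with hlt | heq
      · exact (h b 4 hlt).le
      · rw [hv.injective heq]

theorem strictMono_vec_five {n : ℕ} {i j k a b : Fin n} (h1 : i < j) (h2 : j < k) (h3 : k < a)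
    (h4 : a < b) : StrictMono ![i, j, k, a, b] := by
  refine Fin.strictMono_iff_lt_succ.2 fun c => ?_
  fin_cases c <;> assumption

theorem fillingAvoidsSet_max_first_iff {n : ℕ} {F : FerrersBoard n} {σ : Equiv.Perm (Fin n)}
    (hσ : IsFilling F σ) :
    FillingAvoidsSet F σ {mkPattern ![2,0,1,3,4], mkPattern ![2,1,0,3,4]} ↔
      SparseOn (fun i j => i < j) (ascentShadow σ) (shadowColumns σ) σ := by
  rw [← not_iff_not, not_sparseOn_shadow_iff]
  simp only [FillingAvoidsSet, Set.mem_insert_iff, Set.mem_singleton_iff, forall_eq_or_imp,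
    forall_eq, ← not_or, not_not]
  rw [fillingContains_mkPattern_iff hσ _ rfl, fillingContains_mkPattern_iff hσ _ rfl]
  constructor
  · rintro (⟨f, hf, h⟩ | ⟨f, hf, h⟩) <;>
    exact ⟨f 0, f 1, f 2, hf (by decide), hf (by decide), hf (by decide), h _ _ (by decide),
      h _ _ (by decide), f 3, f 4, hf (by decide), hf (by decide), hf (by decide),
      h _ _ (by decide), h _ _ (by decide)⟩
  · rintro ⟨i, j, k, hjk, hij, -, hj, hk, a, b, -, hka, hab, hσa, hσab⟩
    rcases lt_or_gt_of_ne (σ.injective.ne hjk.ne) with hlt | hlt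
    · refine Or.inl ⟨_, strictMono_vec_five hij hjk hka hab, fun c d hcd => ?_⟩
      fin_cases c <;> fin_cases d <;> simp at hcd ⊢ <;> order
    · refine Or.inr ⟨_, strictMono_vec_five hij hjk hka hab, fun c d hcd => ?_⟩
      fin_cases c <;> fin_cases d <;> simp at hcd ⊢ <;> order

theorem fillingAvoidsSet_max_last_iff {n : ℕ} {F : FerrersBoard n} {σ : Equiv.Perm (Fin n)}
    (hσ : IsFilling F σ) :
    FillingAvoidsSet F σ {mkPattern ![0,1,2,3,4], mkPattern ![1,0,2,3,4]} ↔
      SparseOn (fun i j => j < i) (ascentShadow σ) (shadowColumns σ) σ := by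
  rw [← not_iff_not, not_sparseOn_shadow_iff]
  simp only [FillingAvoidsSet, Set.mem_insert_iff, Set.mem_singleton_iff, forall_eq_or_imp,
    forall_eq, ← not_or, not_not]
  rw [fillingContains_mkPattern_iff hσ _ rfl, fillingContains_mkPattern_iff hσ _ rfl]
  constructor
  · rintro (⟨f, hf, h⟩ | ⟨f, hf, h⟩) <;>
    exact ⟨f 2, f 0, f 1, hf (by decide), hf (by decide), hf (by decide), h _ _ (by decide),
      h _ _ (by decide), f 3, f 4, hf (by decide), hf (by decide), hf (by decide),
      h _ _ (by decide), h _ _ (by decide)⟩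
  · rintro ⟨i, j, k, hjk, -, hki, hj, hk, a, b, hia, -, hab, hσa, hσab⟩
    rcases lt_or_gt_of_ne (σ.injective.ne hjk.ne) with hlt | hlt
    · refine Or.inl ⟨_, strictMono_vec_five hjk hki hia hab, fun c d hcd => ?_⟩
      fin_cases c <;> fin_cases d <;> simp at hcd ⊢ <;> order
    · refine Or.inr ⟨_, strictMono_vec_five hjk hki hia hab, fun c d hcd => ?_⟩
      fin_cases c <;> fin_cases d <;> simp at hcd ⊢ <;> order

/-- The pattern sets {31245, 32145} and {12345, 21345} are shape-Wilf-equivalent. -/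
theorem stmt11 : ShapeWilfEquiv {mkPattern ![2,0,1,3,4], mkPattern ![2,1,0,3,4]} {mkPattern ![0,1,2,3,4], mkPattern ![1,0,2,3,4]} := by
  intro n _ F
  classical
  rw [Nat.card_eq_fintype_card, Nat.card_eq_fintype_card, Fintype.card_subtype,
    Fintype.card_subtype,
    Finset.filter_congr fun σ _ => and_congr_right fun h => fillingAvoidsSet_max_first_iff h,
    Finset.filter_congr fun σ _ => and_congr_right fun h => fillingAvoidsSet_max_last_iff h]
  convert card_filling_sparseOn_shadow F
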